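/- For every integer d ≥ 2 and every natural number n, the counting function T_d satisfies the recurrence 2 · T_d(n) = 2(2n+1) · T_{d-1}(n) − n(n+1) · T_{d-2}(n). -/

import Mathlib

/-- `stT d n` counts the lattice points of the `n`-th dilate of the dual Stasheff
polytope `St_d^*`. -/
noncomputable def stT (d n : ℕ) : ℕ :=
  Set.ncard {x : Fin d → ℤ |
    (∀ i, -(n : ℤ) ≤ x i ∧ x i ≤ (n : ℤ)) ∧
    ∀ j k : Fin d, j < k → ∑ i ∈ Finset.Icc j k, x i ≤ (n : ℤ)}

/-- The explicit condition, with a starting carry `s`. -/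
def stC (n : ℤ) (d : ℕ) (s : ℤ) (x : Fin d → ℤ) : Prop :=
  (∀ i, -n ≤ x i) ∧ (∀ j k : Fin d, j ≤ k → ∑ i ∈ Finset.Icc j k, x i ≤ n) ∧
    ∀ k : Fin d, s + ∑ i ∈ Finset.Iic k, x i ≤ n

lemma st_sum_Icc_succ {d : ℕ} (x : Fin (d+1) → ℤ) (j k : Fin d) :
    ∑ i ∈ Finset.Icc j.succ k.succ, x i = ∑ i ∈ Finset.Icc j k, x i.succ := by
  have : Finset.Icc j.succ k.succ = (Finset.Icc j k).map (Fin.succEmb d) := by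
    ext i
    refine Fin.cases ?_ (fun i => ?_) i
    · simp
    · simp
  rw [this, Finset.sum_map]; rfl

lemma st_sum_Iic_succ {d : ℕ} (x : Fin (d+1) → ℤ) (k : Fin d) :
    ∑ i ∈ Finset.Iic k.succ, x i = x 0 + ∑ i ∈ Finset.Iic k, x i.succ := by
  have : Finset.Iic k.succ = insert 0 ((Finset.Iic k).map (Fin.succEmb d)) := by
    ext i
    refine Fin.cases ?_ (fun i => ?_) i
    · simp
    · simp
  rw [this, Finset.sum_insert (by simp), Finset.sum_map]; rfl

lemma st_sum_Icc_zero {d : ℕ} (x : Fin (d+1) → ℤ) (k : Fin (d+1)) :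
    ∑ i ∈ Finset.Icc 0 k, x i = ∑ i ∈ Finset.Iic k, x i := by
  congr 1

lemma st_sum_Iic_zero {d : ℕ} (x : Fin (d+1) → ℤ) :
    ∑ i ∈ Finset.Iic 0, x i = x 0 := by
  have : Finset.Iic (0 : Fin (d+1)) = {0} := by ext i; simp
  rw [this]; simp

lemma stC_succ (n : ℤ) (d : ℕ) (s : ℤ) (hs : 0 ≤ s) (x : Fin (d+1) → ℤ) :
    stC n (d+1) s x ↔
      (-n ≤ x 0 ∧ x 0 ≤ n - s) ∧ stC n d (max (s + x 0) 0) (fun i => x i.succ) := by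
  constructor
  · rintro ⟨h1, h2, h3⟩
    refine ⟨⟨h1 0, ?_⟩, fun i => h1 _, fun j k hjk => ?_, fun k => ?_⟩
    · have := h3 0
      rw [st_sum_Iic_zero] at this; omega
    · rw [← st_sum_Icc_succ]; exact h2 _ _ (by simpa using hjk)
    · show max (s + x 0) 0 + ∑ i ∈ Finset.Iic k, x i.succ ≤ n
      have a := h3 k.succ
      rw [st_sum_Iic_succ] at a
      have b := h2 (Fin.succ ⟨0, by have := k.2; omega⟩) k.succ (by simp [Fin.le_def])
      rw [st_sum_Icc_succ] at b
      have e : Finset.Icc (⟨0, by have := k.2; omega⟩ : Fin d) k = Finset.Iic k := by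
        ext i; rw [Finset.mem_Icc, Finset.mem_Iic]; exact ⟨fun h => h.2, fun h => ⟨Nat.zero_le _, h⟩⟩
      rw [e] at b
      rcases max_choice (s + x 0) 0 with h | h <;> rw [h] <;> omega
  · rintro ⟨⟨h0, h0'⟩, h1, h2, h3⟩
    have h4 : ∀ k : Fin (d+1), s + ∑ i ∈ Finset.Iic k, x i ≤ n := by
      intro k
      refine Fin.cases ?_ (fun k => ?_) k
      · rw [st_sum_Iic_zero]; omega
      · rw [st_sum_Iic_succ]
        have h5 : max (s + x 0) 0 + ∑ i ∈ Finset.Iic k, x i.succ ≤ n := h3 k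
        have := le_max_left (s + x 0) 0
        omega
    refine ⟨fun i => Fin.cases h0 h1 i, fun j => ?_, h4⟩
    refine Fin.cases ?_ (fun j => ?_) j
    · intro k _
      rw [st_sum_Icc_zero]
      have := h4 k
      omega
    · intro k
      refine Fin.cases ?_ (fun k => ?_) k
      · intro h; simp at h
      · intro h
        rw [st_sum_Icc_succ]; exact h2 _ _ (by simpa using h)

/-- Finset of solutions, built recursively. -/
noncomputable def stG (n : ℤ) : (d : ℕ) → ℤ → Finset (Fin d → ℤ)
  | 0, _ => Finset.univ
  | d+1, s => (Finset.Icc (-n) (n - s)).biUnion fun y =>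
      (stG n d (max (s + y) 0)).image fun z => (Fin.cons y z : Fin (d+1) → ℤ)

lemma mem_stG (n : ℤ) (d : ℕ) : ∀ (s : ℤ) (_ : 0 ≤ s) (x : Fin d → ℤ),
    x ∈ stG n d s ↔ stC n d s x := by
  induction d with
  | zero => intro s _ x; simp [stG, stC, eq_iff_true_of_subsingleton]
  | succ d ih =>
    intro s hs x
    rw [stC_succ n d s hs, ← ih _ (le_max_right _ _)]
    simp only [stG, Finset.mem_biUnion, Finset.mem_image, Finset.mem_Icc]
    constructor
    · rintro ⟨y, hy, z, hz, rfl⟩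
      simpa using ⟨hy, hz⟩
    · rintro ⟨h, h'⟩
      exact ⟨x 0, h, _, h', Fin.cons_self_tail x⟩

lemma stG_card_succ (n : ℤ) (d : ℕ) (s : ℤ) :
    (stG n (d+1) s).card =
      ∑ y ∈ Finset.Icc (-n) (n - s), (stG n d (max (s + y) 0)).card := by
  rw [stG, Finset.card_biUnion]
  · refine Finset.sum_congr rfl fun y _ => ?_
    exact Finset.card_image_of_injective _ (Fin.cons_right_injective (α := fun _ => ℤ) y)
  · intro a _ b _ hab
    simp only [Function.onFun]
    rw [Finset.disjoint_left]
    intro x hx hx'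
    simp only [Finset.mem_image] at hx hx'
    obtain ⟨z, _, rfl⟩ := hx
    obtain ⟨w, _, h⟩ := hx'
    have := congrFun h 0
    simp at this
    exact hab this.symm

lemma stG_card_succ' (n : ℕ) (d : ℕ) (s : ℕ) (hs : s ≤ n) :
    ((stG n (d+1) s).card : ℤ) = (n - s) * (stG n d 0).card
      + ∑ t ∈ Finset.range (n+1), ((stG n d t).card : ℤ) := by
  rw [stG_card_succ]
  push_cast
  have h : Finset.Icc (-(n:ℤ)) (n - s) =
      Finset.Ico (-(n:ℤ)) (-s) ∪ (Finset.range (n+1)).image (fun t : ℕ => (t : ℤ) - s) := by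
    ext y
    simp only [Finset.mem_Icc, Finset.mem_union, Finset.mem_Ico, Finset.mem_image,
      Finset.mem_range]
    constructor
    · intro h
      by_cases h' : y < -s
      · left; omega
      · right; exact ⟨(y + s).toNat, by omega, by omega⟩
    · rintro (h | ⟨t, h, rfl⟩) <;> omega
  rw [h, Finset.sum_union, Finset.sum_image]
  · congr 1
    · rw [Finset.sum_congr rfl (g := fun _ => ((stG n d 0).card : ℤ))]
      · simp only [Finset.sum_const, Int.card_Ico, nsmul_eq_mul]
        congr 1; omega
      · intro y hy
        rw [Finset.mem_Ico] at hy
        rw [max_eq_right (by omega)]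
    · refine Finset.sum_congr rfl fun t _ => ?_
      rw [max_eq_left (by omega)]; simp
  · intro a _ b _ h; simpa using h
  · rw [Finset.disjoint_left]
    intro y hy hy'
    simp only [Finset.mem_Ico, Finset.mem_image] at hy hy'
    obtain ⟨t, _, rfl⟩ := hy'
    omega

lemma stT_eq (d n : ℕ) : stT d n = (stG n d 0).card := by
  rw [stT, ← Set.ncard_coe_finset]
  congr 1
  ext x
  rw [Finset.mem_coe, mem_stG _ _ _ le_rfl, stC, Set.mem_ofPred_eq]
  constructor
  · rintro ⟨h1, h2⟩
    have h3 : ∀ j k : Fin d, j ≤ k → ∑ i ∈ Finset.Icc j k, x i ≤ (n : ℤ) := by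
      intro j k hjk
      rcases hjk.eq_or_lt with rfl | h
      · simpa using (h1 j).2
      · exact h2 _ _ h
    refine ⟨fun i => (h1 i).1, h3, fun k => ?_⟩
    have b := h3 ⟨0, by have := k.2; omega⟩ k (by simp [Fin.le_def])
    have e : Finset.Icc (⟨0, by have := k.2; omega⟩ : Fin d) k = Finset.Iic k := by
      ext i; rw [Finset.mem_Icc, Finset.mem_Iic]; exact ⟨fun h => h.2, fun h => ⟨Nat.zero_le _, h⟩⟩
    rw [e] at b
    omega
  · rintro ⟨h1, h2, _⟩
    exact ⟨fun i => ⟨h1 i, by simpa using h2 i i le_rfl⟩, fun j k h => h2 j k h.le⟩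

/-- The recurrence `2 T_d(n) = 2(2n+1) T_{d-1}(n) - n(n+1) T_{d-2}(n)` for `d ≥ 2`. -/
theorem stasheff_dual_recurrence (d : ℕ) (hd : 2 ≤ d) (n : ℕ) :
    (2 : ℤ) * (stT d n : ℤ) =
      2 * (2 * (n : ℤ) + 1) * (stT (d - 1) n : ℤ)
        - (n : ℤ) * ((n : ℤ) + 1) * (stT (d - 2) n : ℤ) := by
  obtain ⟨d, rfl⟩ := Nat.exists_eq_add_of_le' hd
  simp only [stT_eq, Nat.add_sub_cancel, show d + 2 - 1 = d + 1 from rfl]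
  have e1 := stG_card_succ' n (d+1) 0 (Nat.zero_le _)
  have e2 := stG_card_succ' n d 0 (Nat.zero_le _)
  have e3 : ∑ t ∈ Finset.range (n+1), ((stG n (d+1) t).card : ℤ)
      = (∑ t ∈ Finset.range (n+1), ((n : ℤ) - t)) * (stG n d 0).card
        + (n + 1) * ∑ t ∈ Finset.range (n+1), ((stG n d t).card : ℤ) := by
    rw [Finset.sum_congr rfl fun t ht =>
      stG_card_succ' n d t (by rw [Finset.mem_range] at ht; omega)]
    rw [Finset.sum_add_distrib, Finset.sum_mul]
    simp
  have e4 : ∀ m : ℕ, 2 * ∑ t ∈ Finset.range m, ((n : ℤ) - t) = m * (2 * n + 1 - m) := by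
    intro m
    induction m with
    | zero => simp
    | succ m ih => rw [Finset.sum_range_succ, mul_add, ih]; push_cast; ring
  have e5 := e4 (n+1)
  push_cast at e1 e2 e5
  rw [e3] at e1
  generalize (∑ t ∈ Finset.range (n+1), ((n : ℤ) - t)) = A at *
  generalize (∑ t ∈ Finset.range (n+1), ((stG n d t).card : ℤ)) = S at *
  rw [show d + 1 + 1 = d + 2 from rfl] at e1
  linear_combination 2 * e1 - 2 * (n + 1) * e2 + ((stG n d 0).card : ℤ) * e5
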